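/- arXiv:2312.04939 — 7 statements merged into one kernel-verified Lean document; each statement's English description precedes it below -/
import Mathlib

section
/- Let X be a real inner product space, τ ∈ ℝ, and let m, v : ℕ → X be sequences such that ‖m 0‖ = 1 and, for all i ∈ ℕ, ⟨m i, v i⟩ = 0 and m (i+1) = m i + τ • (v i). Then for all j ∈ ℕ one has ‖m j‖² = 1 + τ² Σ_{i=0}^{j−1} ‖v i‖²; in particular ‖m j‖ ≥ 1 and ‖m j‖² − 1 = τ² Σ_{i=0}^{j−1} ‖v i‖² ≥ 0. -/
open scoped RealInnerProductSpace

/-- Core identity of the projection-free update: if `‖m 0‖ = 1`, `⟨m i, v i⟩ = 0`, and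
`m (i+1) = m i + τ v i` for all `i`, then
`‖m j‖² = 1 + τ² Σ_{i<j} ‖v i‖²`; in particular `‖m j‖ ≥ 1` and
`‖m j‖² − 1 = τ² Σ_{i<j} ‖v i‖² ≥ 0`. -/
theorem projection_free_constraint_identity
    {X : Type*} [NormedAddCommGroup X] [InnerProductSpace ℝ X]
    (τ : ℝ) (m v : ℕ → X) (hm0 : ‖m 0‖ = 1)
    (horth : ∀ i : ℕ, ⟪m i, v i⟫ = 0)
    (hupd : ∀ i : ℕ, m (i + 1) = m i + τ • v i) :
    ∀ j : ℕ,
      ‖m j‖ ^ 2 = 1 + τ ^ 2 * ∑ i ∈ Finset.range j, ‖v i‖ ^ 2 ∧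
      1 ≤ ‖m j‖ ∧
      ‖m j‖ ^ 2 - 1 = τ ^ 2 * ∑ i ∈ Finset.range j, ‖v i‖ ^ 2 ∧
      0 ≤ τ ^ 2 * ∑ i ∈ Finset.range j, ‖v i‖ ^ 2 := by
  intro j
  have key : ‖m j‖ ^ 2 = 1 + τ ^ 2 * ∑ i ∈ Finset.range j, ‖v i‖ ^ 2 := by
    induction j with
    | zero => simp [hm0]
    | succ k ih =>
      rw [hupd, norm_add_sq_real, inner_smul_right, horth, norm_smul, mul_pow,
        Real.norm_eq_abs, sq_abs, ih, Finset.sum_range_succ]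
      ring
  have nonneg : 0 ≤ τ ^ 2 * ∑ i ∈ Finset.range j, ‖v i‖ ^ 2 := by positivity
  refine ⟨key, ?_, by linarith, nonneg⟩
  exact (one_le_sq_iff₀ (norm_nonneg _)).mp (by linarith)
end

section
/- Let U and W be real inner product spaces, D : U →ₗ[ℝ] W a linear map, B a bilinear form on U, and a₁₁, a₂₂, a₁₂, a₀, θ₁, θ₂, θ₃, τ real numbers. Define E(m₁,m₂) := (1/2)a₁₁‖Dm₁‖² + (1/2)a₂₂‖Dm₂‖² + a₁₂⟨Dm₁, Dm₂⟩ − a₀⟨m₁, m₂⟩. Suppose m₁, m₂, v₁, v₂ ∈ U satisfy the tested scheme equation: B(v₁,v₁) + B(v₂,v₂) + θ₁τ(a₁₁‖Dv₁‖² + a₂₂‖Dv₂‖²) + 2a₁₂θ₂τ⟨Dv₁, Dv₂⟩ − 2a₀θ₃τ⟨v₁, v₂⟩ = −a₁₁⟨Dm₁, Dv₁⟩ − a₂₂⟨Dm₂, Dv₂⟩ − a₁₂(⟨Dm₂, Dv₁⟩ + ⟨Dm₁, Dv₂⟩) + a₀(⟨m₂, v₁⟩ + ⟨m₁, v₂⟩).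 Then E(m₁ + τv₁, m₂ + τv₂) − E(m₁, m₂) = −τ(B(v₁,v₁) + B(v₂,v₂)) − ((2θ₁−1)/2)τ²(a₁₁‖Dv₁‖² + a₂₂‖Dv₂‖²) − a₁₂(2θ₂−1)τ²⟨Dv₁, Dv₂⟩ + a₀(2θ₃−1)τ²⟨v₁, v₂⟩. -/
open scoped RealInnerProductSpace

/-- Discrete energy law of the general discrete gradient flow (Algorithm 6.1):
if the updates satisfy the tested scheme equation, then the exchange energy satisfies
the identity of Proposition 6.3. -/
theorem general_scheme_energy_law
    {U W : Type*} [NormedAddCommGroup U] [InnerProductSpace ℝ U]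
    [NormedAddCommGroup W] [InnerProductSpace ℝ W]
    (D : U →ₗ[ℝ] W) (B : U →ₗ[ℝ] U →ₗ[ℝ] ℝ)
    (a₁₁ a₂₂ a₁₂ a₀ θ₁ θ₂ θ₃ τ : ℝ)
    (E : U → U → ℝ)
    (hE : ∀ m₁ m₂ : U, E m₁ m₂ =
      (1 / 2) * a₁₁ * ‖D m₁‖ ^ 2 + (1 / 2) * a₂₂ * ‖D m₂‖ ^ 2
        + a₁₂ * ⟪D m₁, D m₂⟫ - a₀ * ⟪m₁, m₂⟫)
    (m₁ m₂ v₁ v₂ : U)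
    (hscheme :
      B v₁ v₁ + B v₂ v₂ + θ₁ * τ * (a₁₁ * ‖D v₁‖ ^ 2 + a₂₂ * ‖D v₂‖ ^ 2)
          + 2 * a₁₂ * θ₂ * τ * ⟪D v₁, D v₂⟫ - 2 * a₀ * θ₃ * τ * ⟪v₁, v₂⟫
        = -(a₁₁ * ⟪D m₁, D v₁⟫) - a₂₂ * ⟪D m₂, D v₂⟫
          - a₁₂ * (⟪D m₂, D v₁⟫ + ⟪D m₁, D v₂⟫)
          + a₀ * (⟪m₂, v₁⟫ + ⟪m₁, v₂⟫)) :
    E (m₁ + τ • v₁) (m₂ + τ • v₂) - E m₁ m₂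
      = -(τ * (B v₁ v₁ + B v₂ v₂))
        - ((2 * θ₁ - 1) / 2) * τ ^ 2 * (a₁₁ * ‖D v₁‖ ^ 2 + a₂₂ * ‖D v₂‖ ^ 2)
        - a₁₂ * (2 * θ₂ - 1) * τ ^ 2 * ⟪D v₁, D v₂⟫
        + a₀ * (2 * θ₃ - 1) * τ ^ 2 * ⟪v₁, v₂⟫ := by
  simp only [hE, map_add, map_smul, norm_add_sq_real, norm_smul, mul_pow, Real.norm_eq_abs, sq_abs,
    inner_add_left, inner_add_right, real_inner_smul_left, real_inner_smul_right]
  rw [real_inner_comm (D m₂) (D v₁), real_inner_comm m₂ v₁] at *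
  linear_combination τ * hscheme
end

section
/- Let U and W be real inner product spaces, D : U →ₗ[ℝ] W a linear map, B a bilinear form on U, and a₁₁, a₂₂, a₁₂, a₀, τ real numbers. Define E(m₁,m₂) := (1/2)a₁₁‖Dm₁‖² + (1/2)a₂₂‖Dm₂‖² + a₁₂⟨Dm₁, Dm₂⟩ − a₀⟨m₁, m₂⟩. Suppose m₁, m₂, v₁, v₂ ∈ U satisfy: B(v₁,v₁) + B(v₂,v₂) + τ(a₁₁‖Dv₁‖² + a₂₂‖Dv₂‖²) + a₁₂τ⟨Dv₁, Dv₂⟩ − a₀τ⟨v₁, v₂⟩ = −a₁₁⟨Dm₁, Dv₁⟩ − a₂₂⟨Dm₂, Dv₂⟩ − a₁₂(⟨Dm₂, Dv₁⟩ + ⟨Dm₁, Dv₂⟩) + a₀(⟨m₂, v₁⟩ + ⟨m₁, v₂⟩). Then E(m₁ + τv₁, m₂ + τv₂) − E(m₁, m₂) = −τ(B(v₁,v₁) + B(v₂,v₂)) − (τ²/2)(a₁₁‖Dv₁‖² + a₂₂‖Dv₂‖²). In particular, if τ ≥ 0, a₁₁ ≥ 0, a₂₂ ≥ 0 and B(φ,φ)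 ≥ 0 for all φ ∈ U, then E(m₁ + τv₁, m₂ + τv₂) ≤ E(m₁, m₂). -/
open scoped RealInnerProductSpace

/-- Discrete energy law of the coupled discrete gradient flow (Algorithm 4.3,
i.e. θ₁ = 1, θ₂ = θ₃ = 1/2): the exchange energy satisfies the identity of
Proposition 4.3(iii); in particular, if `τ ≥ 0`, `a₁₁, a₂₂ ≥ 0` and `B` is positive
semidefinite, the energy decreases. -/
theorem coupled_scheme_energy_law
    {U W : Type*} [NormedAddCommGroup U] [InnerProductSpace ℝ U]
    [NormedAddCommGroup W] [InnerProductSpace ℝ W]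
    (D : U →ₗ[ℝ] W) (B : U →ₗ[ℝ] U →ₗ[ℝ] ℝ)
    (a₁₁ a₂₂ a₁₂ a₀ τ : ℝ)
    (E : U → U → ℝ)
    (hE : ∀ m₁ m₂ : U, E m₁ m₂ =
      (1 / 2) * a₁₁ * ‖D m₁‖ ^ 2 + (1 / 2) * a₂₂ * ‖D m₂‖ ^ 2
        + a₁₂ * ⟪D m₁, D m₂⟫ - a₀ * ⟪m₁, m₂⟫)
    (m₁ m₂ v₁ v₂ : U)
    (hscheme :
      B v₁ v₁ + B v₂ v₂ + τ * (a₁₁ * ‖D v₁‖ ^ 2 + a₂₂ * ‖D v₂‖ ^ 2)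
          + a₁₂ * τ * ⟪D v₁, D v₂⟫ - a₀ * τ * ⟪v₁, v₂⟫
        = -(a₁₁ * ⟪D m₁, D v₁⟫) - a₂₂ * ⟪D m₂, D v₂⟫
          - a₁₂ * (⟪D m₂, D v₁⟫ + ⟪D m₁, D v₂⟫)
          + a₀ * (⟪m₂, v₁⟫ + ⟪m₁, v₂⟫)) :
    (E (m₁ + τ • v₁) (m₂ + τ • v₂) - E m₁ m₂
      = -(τ * (B v₁ v₁ + B v₂ v₂))
        - (τ ^ 2 / 2) * (a₁₁ * ‖D v₁‖ ^ 2 + a₂₂ * ‖D v₂‖ ^ 2)) ∧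
    (0 ≤ τ → 0 ≤ a₁₁ → 0 ≤ a₂₂ → (∀ φ : U, 0 ≤ B φ φ) →
      E (m₁ + τ • v₁) (m₂ + τ • v₂) ≤ E m₁ m₂) := by
  have energy_identity : E (m₁ + τ • v₁) (m₂ + τ • v₂) - E m₁ m₂
      = -(τ * (B v₁ v₁ + B v₂ v₂))
        - (τ ^ 2 / 2) * (a₁₁ * ‖D v₁‖ ^ 2 + a₂₂ * ‖D v₂‖ ^ 2) := by
    simp only [hE, map_add, map_smul, norm_add_sq_real, norm_smul, mul_pow, Real.norm_eq_abs,
      sq_abs, inner_add_left, inner_add_right, real_inner_smul_left, real_inner_smul_right]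
    rw [real_inner_comm (D v₁) (D m₂), real_inner_comm v₁ m₂] at hscheme
    linear_combination τ * hscheme
  refine ⟨energy_identity, fun hτ h₁ h₂ hB => ?_⟩
  have dissipation_nonneg : 0 ≤ τ * (B v₁ v₁ + B v₂ v₂) :=
    mul_nonneg hτ (add_nonneg (hB v₁) (hB v₂))
  have gradient_nonneg :
      0 ≤ (τ ^ 2 / 2) * (a₁₁ * ‖D v₁‖ ^ 2 + a₂₂ * ‖D v₂‖ ^ 2) := by
    positivity
  linarith
end

section
/- Let U and W be real inner product spaces, D : U →ₗ[ℝ] W a linear map, B a bilinear form on U, and a₁₁, a₂₂, a₁₂, a₀, τ real numbers. Define E(m₁,m₂) := (1/2)a₁₁‖Dm₁‖² + (1/2)a₂₂‖Dm₂‖² + a₁₂⟨Dm₁, Dm₂⟩ − a₀⟨m₁, m₂⟩. Suppose m₁, m₂, v₁, v₂ ∈ U satisfy: B(v₁,v₁) + B(v₂,v₂) + τ(a₁₁‖Dv₁‖² + a₂₂‖Dv₂‖²) = −a₁₁⟨Dm₁, Dv₁⟩ − a₂₂⟨Dm₂, Dv₂⟩ − a₁₂(⟨Dm₂, Dv₁⟩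 + ⟨Dm₁, Dv₂⟩) + a₀(⟨m₂, v₁⟩ + ⟨m₁, v₂⟩). Then E(m₁ + τv₁, m₂ + τv₂) − E(m₁, m₂) = −τ(B(v₁,v₁) + B(v₂,v₂)) − (τ²/2)(a₁₁‖Dv₁‖² + a₂₂‖Dv₂‖²) + a₁₂τ²⟨Dv₁, Dv₂⟩ − a₀τ²⟨v₁, v₂⟩. Moreover, if additionally τ ≥ 0, a₁₁ + a₂₂ > 0, a₁₁a₂₂ ≥ a₁₂², and there is c > 0 with B(φ,φ) ≥ c⁻²‖φ‖² for all φ ∈ U and c²|a₀|τ ≤ 2, then E(m₁ + τv₁, m₂ + τv₂) ≤ E(m₁, m₂). -/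
open scoped RealInnerProductSpace

/-- A positive semidefinite `2 × 2` quadratic form dominates the corresponding cross term
of two vectors in an inner product space. -/
theorem two_mul_inner_le_of_sq_le_mul {W : Type*} [NormedAddCommGroup W] [InnerProductSpace ℝ W]
    {a b k : ℝ} (ha : 0 ≤ a) (hb : 0 ≤ b) (hk : k ^ 2 ≤ a * b) (x y : W) :
    2 * (k * ⟪x, y⟫) ≤ a * ‖x‖ ^ 2 + b * ‖y‖ ^ 2 := by
  have hs : ⟪x, y⟫ ^ 2 ≤ ‖x‖ ^ 2 * ‖y‖ ^ 2 := by
    rw [← mul_pow]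
    exact sq_le_sq' (abs_le.mp (abs_real_inner_le_norm x y)).1 (real_inner_le_norm x y)
  have h : k ^ 2 * ⟪x, y⟫ ^ 2 ≤ (a * b) * (‖x‖ ^ 2 * ‖y‖ ^ 2) :=
    mul_le_mul hk hs (sq_nonneg _) (mul_nonneg ha hb)
  refine le_of_abs_le (abs_le_of_sq_le_sq ?_ (by positivity))
  nlinarith [sq_nonneg (a * ‖x‖ ^ 2 - b * ‖y‖ ^ 2)]

/-- Discrete energy law of the decoupled discrete gradient flow (Algorithm 4.4,
i.e. θ₁ = 1, θ₂ = θ₃ = 0): the exchange energy satisfies the identity of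
Proposition 4.4(iii); moreover, under `τ ≥ 0`, `a₁₁ + a₂₂ > 0`, `a₁₁ a₂₂ ≥ a₁₂²`,
a coercivity bound `B(φ,φ) ≥ c⁻²‖φ‖²` and the time-step restriction `c²|a₀|τ ≤ 2`,
the energy decreases. -/
theorem decoupled_scheme_energy_law
    {U W : Type*} [NormedAddCommGroup U] [InnerProductSpace ℝ U]
    [NormedAddCommGroup W] [InnerProductSpace ℝ W]
    (D : U →ₗ[ℝ] W) (B : U →ₗ[ℝ] U →ₗ[ℝ] ℝ)
    (a₁₁ a₂₂ a₁₂ a₀ τ : ℝ)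
    (E : U → U → ℝ)
    (hE : ∀ m₁ m₂ : U, E m₁ m₂ =
      (1 / 2) * a₁₁ * ‖D m₁‖ ^ 2 + (1 / 2) * a₂₂ * ‖D m₂‖ ^ 2
        + a₁₂ * ⟪D m₁, D m₂⟫ - a₀ * ⟪m₁, m₂⟫)
    (m₁ m₂ v₁ v₂ : U)
    (hscheme :
      B v₁ v₁ + B v₂ v₂ + τ * (a₁₁ * ‖D v₁‖ ^ 2 + a₂₂ * ‖D v₂‖ ^ 2)
        = -(a₁₁ * ⟪D m₁, D v₁⟫) - a₂₂ * ⟪D m₂, D v₂⟫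
          - a₁₂ * (⟪D m₂, D v₁⟫ + ⟪D m₁, D v₂⟫)
          + a₀ * (⟪m₂, v₁⟫ + ⟪m₁, v₂⟫)) :
    (E (m₁ + τ • v₁) (m₂ + τ • v₂) - E m₁ m₂
      = -(τ * (B v₁ v₁ + B v₂ v₂))
        - (τ ^ 2 / 2) * (a₁₁ * ‖D v₁‖ ^ 2 + a₂₂ * ‖D v₂‖ ^ 2)
        + a₁₂ * τ ^ 2 * ⟪D v₁, D v₂⟫ - a₀ * τ ^ 2 * ⟪v₁, v₂⟫) ∧
    (0 ≤ τ → 0 < a₁₁ + a₂₂ → a₁₂ ^ 2 ≤ a₁₁ * a₂₂ →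
      ∀ c : ℝ, 0 < c → (∀ φ : U, (c ^ 2)⁻¹ * ‖φ‖ ^ 2 ≤ B φ φ) →
        c ^ 2 * |a₀| * τ ≤ 2 →
        E (m₁ + τ • v₁) (m₂ + τ • v₂) ≤ E m₁ m₂) := by
  have hident : E (m₁ + τ • v₁) (m₂ + τ • v₂) - E m₁ m₂
      = -(τ * (B v₁ v₁ + B v₂ v₂))
        - (τ ^ 2 / 2) * (a₁₁ * ‖D v₁‖ ^ 2 + a₂₂ * ‖D v₂‖ ^ 2)
        + a₁₂ * τ ^ 2 * ⟪D v₁, D v₂⟫ - a₀ * τ ^ 2 * ⟪v₁, v₂⟫ := by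
    simp only [hE, map_add, map_smul, norm_add_sq_real, norm_smul, mul_pow, Real.norm_eq_abs,
      sq_abs, inner_add_left, inner_add_right, real_inner_smul_left, real_inner_smul_right]
    rw [real_inner_comm (D v₁) (D m₂), real_inner_comm v₁ m₂] at hscheme
    linear_combination τ * hscheme
  refine ⟨hident, fun hτ hsum hdet c hc hB hstep => ?_⟩
  have hprod : 0 ≤ a₁₁ * a₂₂ := (sq_nonneg a₁₂).trans hdet
  have ha₁₁ : 0 ≤ a₁₁ := by
    by_contra! h
    nlinarith
  have ha₂₂ : 0 ≤ a₂₂ := by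
    by_contra! h
    nlinarith
  have hexch := mul_nonneg (sq_nonneg τ)
    (sub_nonneg.mpr (two_mul_inner_le_of_sq_le_mul ha₁₁ ha₂₂ hdet (D v₁) (D v₂)))
  have hcross : 2 * (-a₀ * ⟪v₁, v₂⟫) ≤ |a₀| * ‖v₁‖ ^ 2 + |a₀| * ‖v₂‖ ^ 2 :=
    two_mul_inner_le_of_sq_le_mul (abs_nonneg a₀) (abs_nonneg a₀)
      (by rw [neg_sq, abs_mul_abs_self, sq]) v₁ v₂
  have hstep' : |a₀| * τ ≤ 2 * (c ^ 2)⁻¹ := by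
    rw [← div_eq_mul_inv, le_div_iff₀ (by positivity)]
    linarith
  have hbound : τ * (-a₀ * ⟪v₁, v₂⟫) ≤ B v₁ v₁ + B v₂ v₂ := by
    have h₁ := mul_le_mul_of_nonneg_left hcross hτ
    have h₂ := mul_le_mul_of_nonneg_right hstep' (add_nonneg (sq_nonneg ‖v₁‖) (sq_nonneg ‖v₂‖))
    linarith [hB v₁, hB v₂]
  have := mul_le_mul_of_nonneg_left hbound hτ
  linarith
end

section
/- Let U and W be real inner product spaces, D : U →ₗ[ℝ] W a linear map, B a bilinear form on U, and a₁₁ > 0, a₂₂ > 0, a₁₂, a₀ ∈ ℝ, θ₁, θ₂, θ₃ ∈ ℝ, τ ≥ 0. Define E(m₁,m₂) := (1/2)a₁₁‖Dm₁‖² + (1/2)a₂₂‖Dm₂‖² + a₁₂⟨Dm₁, Dm₂⟩ − a₀⟨m₁, m₂⟩. Assume θ₁ ≥ 1/2, a₁₁a₂₂(2θ₁−1)² ≥ a₁₂²(2θ₂−1)², and there exists c > 0 with B(φ,φ) ≥ c⁻²‖φ‖² for all φ ∈ U and c²|a₀||2θ₃−1|τ ≤ 2. If m₁, m₂, v₁,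 v₂ ∈ U satisfy the tested scheme equation B(v₁,v₁) + B(v₂,v₂) + θ₁τ(a₁₁‖Dv₁‖² + a₂₂‖Dv₂‖²) + 2a₁₂θ₂τ⟨Dv₁, Dv₂⟩ − 2a₀θ₃τ⟨v₁, v₂⟩ = −a₁₁⟨Dm₁, Dv₁⟩ − a₂₂⟨Dm₂, Dv₂⟩ − a₁₂(⟨Dm₂, Dv₁⟩ + ⟨Dm₁, Dv₂⟩) + a₀(⟨m₂, v₁⟩ + ⟨m₁, v₂⟩), then E(m₁ + τv₁, m₂ + τv₂) ≤ E(m₁, m₂). -/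
open scoped RealInnerProductSpace

/-- A quadratic form `α‖x‖² + β‖y‖²` dominates an inner product whose coefficient satisfies the
discriminant condition `g² ≤ αβk²`. -/
lemma weighted_norm_sq_add_inner_nonneg {W : Type*} [NormedAddCommGroup W]
    [InnerProductSpace ℝ W] {α β g k : ℝ} (hα : 0 ≤ α) (hβ : 0 ≤ β) (hk : 0 ≤ k)
    (hg : g ^ 2 ≤ α * β * k ^ 2) (x y : W) :
    0 ≤ k * (α * ‖x‖ ^ 2 + β * ‖y‖ ^ 2) + 2 * g * ⟪x, y⟫ := by
  have hxy : ⟪x, y⟫ ^ 2 ≤ ‖x‖ ^ 2 * ‖y‖ ^ 2 := by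
    rw [← mul_pow]
    exact sq_le_sq.2 ((abs_real_inner_le_norm x y).trans (le_abs_self _))
  have hsq : (2 * g * ⟪x, y⟫) ^ 2 ≤ (k * (α * ‖x‖ ^ 2 + β * ‖y‖ ^ 2)) ^ 2 := by
    have hmul : g ^ 2 * ⟪x, y⟫ ^ 2 ≤ α * β * k ^ 2 * (‖x‖ ^ 2 * ‖y‖ ^ 2) :=
      mul_le_mul hg hxy (sq_nonneg _) (by positivity)
    linarith [sq_nonneg (k * (α * ‖x‖ ^ 2 - β * ‖y‖ ^ 2))]
  linarith [(abs_le.1 (abs_le_of_sq_le_sq hsq (by positivity))).1]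

/-- Energy decrease of the general discrete gradient flow scheme (Algorithm 6.1):
under the conditions `θ₁ ≥ 1/2`, `a₁₁ a₂₂ (2θ₁−1)² ≥ a₁₂² (2θ₂−1)²`,
`B(φ,φ) ≥ c⁻²‖φ‖²` and `c²|a₀||2θ₃−1|τ ≤ 2`, if the updates satisfy the tested
scheme equation, then the exchange energy is monotonically decreasing. -/
theorem general_scheme_energy_decrease
    {U W : Type*} [NormedAddCommGroup U] [InnerProductSpace ℝ U]
    [NormedAddCommGroup W] [InnerProductSpace ℝ W]
    (D : U →ₗ[ℝ] W) (B : U →ₗ[ℝ] U →ₗ[ℝ] ℝ)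
    (a₁₁ a₂₂ a₁₂ a₀ θ₁ θ₂ θ₃ τ : ℝ)
    (h11 : 0 < a₁₁) (h22 : 0 < a₂₂) (hτ : 0 ≤ τ)
    (E : U → U → ℝ)
    (hE : ∀ m₁ m₂ : U, E m₁ m₂ =
      (1 / 2) * a₁₁ * ‖D m₁‖ ^ 2 + (1 / 2) * a₂₂ * ‖D m₂‖ ^ 2
        + a₁₂ * ⟪D m₁, D m₂⟫ - a₀ * ⟪m₁, m₂⟫)
    (hθ₁ : 1 / 2 ≤ θ₁)
    (hθ₁₂ : a₁₂ ^ 2 * (2 * θ₂ - 1) ^ 2 ≤ a₁₁ * a₂₂ * (2 * θ₁ - 1) ^ 2)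
    (c : ℝ) (hc : 0 < c)
    (hB : ∀ φ : U, (c ^ 2)⁻¹ * ‖φ‖ ^ 2 ≤ B φ φ)
    (hτ₃ : c ^ 2 * |a₀| * |2 * θ₃ - 1| * τ ≤ 2)
    (m₁ m₂ v₁ v₂ : U)
    (hscheme :
      B v₁ v₁ + B v₂ v₂ + θ₁ * τ * (a₁₁ * ‖D v₁‖ ^ 2 + a₂₂ * ‖D v₂‖ ^ 2)
          + 2 * a₁₂ * θ₂ * τ * ⟪D v₁, D v₂⟫ - 2 * a₀ * θ₃ * τ * ⟪v₁, v₂⟫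
        = -(a₁₁ * ⟪D m₁, D v₁⟫) - a₂₂ * ⟪D m₂, D v₂⟫
          - a₁₂ * (⟪D m₂, D v₁⟫ + ⟪D m₁, D v₂⟫)
          + a₀ * (⟪m₂, v₁⟫ + ⟪m₁, v₂⟫)) :
    E (m₁ + τ • v₁) (m₂ + τ • v₂) ≤ E m₁ m₂ := by
  have hDv := weighted_norm_sq_add_inner_nonneg (k := 2 * θ₁ - 1) (g := a₁₂ * (2 * θ₂ - 1))
    h11.le h22.le (by linarith) (by rw [mul_pow]; exact hθ₁₂) (D v₁) (D v₂)
  have hcoef : |a₀ * (2 * θ₃ - 1) * τ| ≤ 2 * (c ^ 2)⁻¹ := by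
    rw [abs_mul, abs_mul, abs_of_nonneg hτ, ← div_eq_mul_inv, le_div_iff₀ (by positivity)]
    linarith
  have hv := weighted_norm_sq_add_inner_nonneg (α := 1) (β := 1) (k := 2 * (c ^ 2)⁻¹)
    (g := -(a₀ * (2 * θ₃ - 1) * τ)) zero_le_one zero_le_one (by positivity)
    (by simpa using sq_le_sq.2 (hcoef.trans (le_abs_self _))) v₁ v₂
  have hdiss : 0 ≤ B v₁ v₁ + B v₂ v₂
      + τ / 2 * ((2 * θ₁ - 1) * (a₁₁ * ‖D v₁‖ ^ 2 + a₂₂ * ‖D v₂‖ ^ 2)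
        + 2 * (a₁₂ * (2 * θ₂ - 1)) * ⟪D v₁, D v₂⟫)
      - a₀ * (2 * θ₃ - 1) * τ * ⟪v₁, v₂⟫ := by
    linarith [hB v₁, hB v₂, mul_nonneg hτ hDv]
  rw [hE, hE]
  simp only [map_add, map_smul, norm_add_sq_real, norm_smul, mul_pow, Real.norm_eq_abs, sq_abs,
    inner_add_left, inner_add_right, real_inner_smul_left, real_inner_smul_right]
  rw [real_inner_comm (D m₂) (D v₁), real_inner_comm m₂ v₁]
  linear_combination mul_nonneg hτ hdiss + τ * hscheme
end

section
/- Let U and W be real inner product spaces, D : U →ₗ[ℝ] W a linear map, and B a bilinear form on U for which there is c > 0 with B(φ,φ) ≥ c⁻²‖φ‖² for all φ ∈ U. Let a₁₁ > 0, a₂₂ > 0, a₁₂ ∈ ℝ, a₀ ∈ ℝ, τ > 0, θ₁ > 0, θ₂ ∈ ℝ, θ₃ ≥ 0, and assume a₁₁a₂₂θ₁² > a₁₂²θ₂² and c²|a₀|θ₃τ < 1. Then there exists β > 0 such that for all φ₁, φ₂ ∈ U: B(φ₁,φ₁) + B(φ₂,φ₂) + a₁₁θ₁τ‖Dφ₁‖²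 + a₂₂θ₁τ‖Dφ₂‖² + 2a₁₂θ₂τ⟨Dφ₁, Dφ₂⟩ − 2a₀θ₃τ⟨φ₁, φ₂⟩ ≥ β(‖φ₁‖² + ‖Dφ₁‖² + ‖φ₂‖² + ‖Dφ₂‖²). -/
open scoped RealInnerProductSpace

/-- A positive definite binary quadratic form is coercive on pairs of vectors of an inner
product space. -/
theorem exists_pos_coercive_binary_form (E : Type*) [NormedAddCommGroup E]
    [InnerProductSpace ℝ E] {p q r : ℝ} (hp : 0 < p) (hq : 0 < q) (hr : r ^ 2 < p * q) :
    ∃ β > (0 : ℝ), ∀ x y : E,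
      β * (‖x‖ ^ 2 + ‖y‖ ^ 2) ≤ p * ‖x‖ ^ 2 + q * ‖y‖ ^ 2 + 2 * r * ⟪x, y⟫ := by
  have hpq : 0 < p + q := add_pos hp hq
  obtain ⟨β, hβ⟩ : ∃ β, β = (p * q - r ^ 2) / (p + q) := ⟨_, rfl⟩
  have hβmul : β * (p + q) = p * q - r ^ 2 := by rw [hβ]; field_simp
  refine ⟨β, hβ ▸ div_pos (sub_pos.2 hr) hpq, fun x y => ?_⟩
  have hpβ : 0 < p - β := by
    refine pos_of_mul_pos_left (b := p + q) ?_ hpq.le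
    nlinarith [sq_nonneg r, pow_pos hp 2]
  have hsq : ‖(p - β) • x + r • y‖ ^ 2 =
      (p - β) ^ 2 * ‖x‖ ^ 2 + 2 * ((p - β) * r * ⟪x, y⟫) + r ^ 2 * ‖y‖ ^ 2 := by
    rw [norm_add_sq_real, norm_smul, norm_smul, mul_pow, mul_pow, Real.norm_eq_abs,
      Real.norm_eq_abs, sq_abs, sq_abs, real_inner_smul_left, real_inner_smul_right]
    ring
  have hmul : (p - β) * ((p - β) * ‖x‖ ^ 2 + (q - β) * ‖y‖ ^ 2 + 2 * r * ⟪x, y⟫) =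
      ‖(p - β) • x + r • y‖ ^ 2 + (β * ‖y‖) ^ 2 := by
    rw [hsq]
    linear_combination (-‖y‖ ^ 2) * hβmul
  have hnonneg := nonneg_of_mul_nonneg_right (hmul.ge.trans' (by positivity)) hpβ
  linarith

/-- Coercivity (with respect to the H¹-norm) of the bilinear form of the general
discrete gradient flow scheme: under `θ₁ > 0`, `a₁₁ a₂₂ θ₁² > a₁₂² θ₂²` and
`c²|a₀|θ₃τ < 1`, there exists `β > 0` such that the diagonal of the scheme's
bilinear form dominates `β` times the H¹-norm squared. -/
theorem general_scheme_coercivity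
    {U W : Type*} [NormedAddCommGroup U] [InnerProductSpace ℝ U]
    [NormedAddCommGroup W] [InnerProductSpace ℝ W]
    (D : U →ₗ[ℝ] W) (B : U →ₗ[ℝ] U →ₗ[ℝ] ℝ)
    (c : ℝ) (hc : 0 < c)
    (hB : ∀ φ : U, (c ^ 2)⁻¹ * ‖φ‖ ^ 2 ≤ B φ φ)
    (a₁₁ a₂₂ a₁₂ a₀ τ θ₁ θ₂ θ₃ : ℝ)
    (h11 : 0 < a₁₁) (h22 : 0 < a₂₂) (hτ : 0 < τ)
    (hθ₁ : 0 < θ₁) (hθ₃ : 0 ≤ θ₃)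
    (hdet : a₁₂ ^ 2 * θ₂ ^ 2 < a₁₁ * a₂₂ * θ₁ ^ 2)
    (hsmall : c ^ 2 * |a₀| * θ₃ * τ < 1) :
    ∃ β > (0 : ℝ), ∀ φ₁ φ₂ : U,
      β * (‖φ₁‖ ^ 2 + ‖D φ₁‖ ^ 2 + ‖φ₂‖ ^ 2 + ‖D φ₂‖ ^ 2) ≤
        B φ₁ φ₁ + B φ₂ φ₂ + a₁₁ * θ₁ * τ * ‖D φ₁‖ ^ 2 + a₂₂ * θ₁ * τ * ‖D φ₂‖ ^ 2
          + 2 * a₁₂ * θ₂ * τ * ⟪D φ₁, D φ₂⟫ - 2 * a₀ * θ₃ * τ * ⟪φ₁, φ₂⟫ := by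
  have hc2 : 0 < c ^ 2 := pow_pos hc 2
  have hzero : |-(a₀ * θ₃ * τ)| < (c ^ 2)⁻¹ := by
    rw [abs_neg, abs_mul, abs_mul, abs_of_nonneg hθ₃, abs_of_pos hτ,
      ← one_div, lt_div_iff₀ hc2]
    linarith
  obtain ⟨β₀, hβ₀, hU⟩ := exists_pos_coercive_binary_form U (inv_pos.2 hc2) (inv_pos.2 hc2)
    (r := -(a₀ * θ₃ * τ)) (by rw [← sq_abs, sq]; gcongr)
  obtain ⟨β₁, hβ₁, hW⟩ := exists_pos_coercive_binary_form W
    (p := a₁₁ * θ₁ * τ) (q := a₂₂ * θ₁ * τ) (r := a₁₂ * θ₂ * τ)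
    (by positivity) (by positivity)
    (by linear_combination τ ^ 2 * hdet)
  refine ⟨min β₀ β₁, lt_min hβ₀ hβ₁, fun φ₁ φ₂ => ?_⟩
  have hβU : min β₀ β₁ * (‖φ₁‖ ^ 2 + ‖φ₂‖ ^ 2) ≤ β₀ * (‖φ₁‖ ^ 2 + ‖φ₂‖ ^ 2) := by
    gcongr
    exact min_le_left _ _
  have hβW : min β₀ β₁ * (‖D φ₁‖ ^ 2 + ‖D φ₂‖ ^ 2) ≤ β₁ * (‖D φ₁‖ ^ 2 + ‖D φ₂‖ ^ 2) := by
    gcongr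
    exact min_le_right _ _
  linarith [hU φ₁ φ₂, hW (D φ₁) (D φ₂), hB φ₁, hB φ₂]
end

section
/- Let U and W be real inner product spaces, D : U →ₗ[ℝ] W a linear map, B a bilinear form on U, and a₁₁, a₂₂, a₁₂, a₀, τ, α₁, α₂, η₁, η₂ real numbers with η₁, η₂ ≠ 0. Define E(m₁,m₂) := (1/2)a₁₁‖Dm₁‖² + (1/2)a₂₂‖Dm₂‖² + a₁₂⟨Dm₁, Dm₂⟩ − a₀⟨m₁, m₂⟩. Suppose m₁, m₂, v₁, v₂ ∈ U satisfy: (α₁/η₁)B(v₁,v₁) + (α₂/η₂)B(v₂,v₂) + τ(a₁₁‖Dv₁‖² + a₂₂‖Dv₂‖²) = −a₁₁⟨Dm₁, Dv₁⟩ − a₂₂⟨Dm₂, Dv₂⟩ − a₁₂(⟨Dm₂, Dv₁⟩ + ⟨Dm₁, Dv₂⟩) + a₀(⟨m₂, v₁⟩ + ⟨m₁, v₂⟩). Then E(m₁ + τv₁, m₂ + τv₂) − E(m₁, m₂) = −τ((α₁/η₁)B(v₁,v₁) + (α₂/η₂)B(v₂,v₂)) − (τ²/2)(a₁₁‖Dv₁‖²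 + a₂₂‖Dv₂‖²) + a₁₂τ²⟨Dv₁, Dv₂⟩ − a₀τ²⟨v₁, v₂⟩. -/
open scoped RealInnerProductSpace

/-- Discrete energy law of the tangent plane scheme (Proposition 5.2(i)):
if the updates satisfy the tested scheme equation, the exchange energy satisfies the
stated identity. -/
theorem tangent_plane_scheme_energy_law
    {U W : Type*} [NormedAddCommGroup U] [InnerProductSpace ℝ U]
    [NormedAddCommGroup W] [InnerProductSpace ℝ W]
    (D : U →ₗ[ℝ] W) (B : U →ₗ[ℝ] U →ₗ[ℝ] ℝ)
    (a₁₁ a₂₂ a₁₂ a₀ τ α₁ α₂ η₁ η₂ : ℝ) (hη₁ : η₁ ≠ 0) (hη₂ : η₂ ≠ 0)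
    (E : U → U → ℝ)
    (hE : ∀ m₁ m₂ : U, E m₁ m₂ =
      (1 / 2) * a₁₁ * ‖D m₁‖ ^ 2 + (1 / 2) * a₂₂ * ‖D m₂‖ ^ 2
        + a₁₂ * ⟪D m₁, D m₂⟫ - a₀ * ⟪m₁, m₂⟫)
    (m₁ m₂ v₁ v₂ : U)
    (hscheme :
      (α₁ / η₁) * B v₁ v₁ + (α₂ / η₂) * B v₂ v₂
          + τ * (a₁₁ * ‖D v₁‖ ^ 2 + a₂₂ * ‖D v₂‖ ^ 2)
        = -(a₁₁ * ⟪D m₁, D v₁⟫) - a₂₂ * ⟪D m₂, D v₂⟫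
          - a₁₂ * (⟪D m₂, D v₁⟫ + ⟪D m₁, D v₂⟫)
          + a₀ * (⟪m₂, v₁⟫ + ⟪m₁, v₂⟫)) :
    E (m₁ + τ • v₁) (m₂ + τ • v₂) - E m₁ m₂
      = -(τ * ((α₁ / η₁) * B v₁ v₁ + (α₂ / η₂) * B v₂ v₂))
        - (τ ^ 2 / 2) * (a₁₁ * ‖D v₁‖ ^ 2 + a₂₂ * ‖D v₂‖ ^ 2)
        + a₁₂ * τ ^ 2 * ⟪D v₁, D v₂⟫ - a₀ * τ ^ 2 * ⟪v₁, v₂⟫ := by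
  simp only [hE, ← real_inner_self_eq_norm_sq, map_add, map_smul, inner_add_left,
    inner_add_right, real_inner_smul_left, real_inner_smul_right] at hscheme ⊢
  rw [real_inner_comm (D m₁) (D v₁), real_inner_comm (D m₂) (D v₂),
    real_inner_comm (D m₂) (D v₁), real_inner_comm m₂ v₁]
  linear_combination τ * hscheme
end
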